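/- arXiv:2511.08293 — 8 statements merged into one kernel-verified Lean document; each statement's English description precedes it below -/
import Mathlib

section
/- Ergodic theorem for random walks on the cycle, sufficiency: let N ≥ 1 and let μ be a probability distribution on ZMod N whose support is not contained in any coset of a proper subgroup of ZMod N. Then for every x ∈ ZMod N, the n-fold convolution power satisfies μ^{⋆n}(x) → 1/N as n → ∞. -/
open Filter

/-- Convolution of two functions on the cycle group `ZMod N`:
`(μ ⋆ ν)(x) = ∑ y, μ (x - y) * ν y`. -/
noncomputable def cycleConv {N : ℕ} [NeZero N] (μ ν : ZMod N → ℝ) : ZMod N → ℝ :=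
  fun x => ∑ y : ZMod N, μ (x - y) * ν y

/-- `n`-fold convolution power of `μ` (with `μ^{⋆0} = δ₀`, so `μ^{⋆1} = μ`). -/
noncomputable def cycleConvPow {N : ℕ} [NeZero N] (μ : ZMod N → ℝ) : ℕ → ZMod N → ℝ
  | 0 => fun x => if x = 0 then 1 else 0
  | n + 1 => cycleConv μ (cycleConvPow μ n)

theorem dft_cycleConv {N : ℕ} [NeZero N] (μ ν : ZMod N → ℝ) (k : ZMod N) :
    ZMod.dft (fun x => (cycleConv μ ν x : ℂ)) k =
      ZMod.dft (fun x => (μ x : ℂ)) k * ZMod.dft (fun x => (ν x : ℂ)) k := by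
  simp only [ZMod.dft_apply, smul_eq_mul, cycleConv, Complex.ofReal_sum, Complex.ofReal_mul,
    Finset.mul_sum]
  rw [Finset.sum_comm]
  refine Finset.sum_congr rfl fun y _ => ?_
  rw [Finset.sum_mul]
  refine Fintype.sum_equiv (Equiv.subRight y) _ _ fun x => ?_
  have hchar : ZMod.stdAddChar (-(x * k)) =
      ZMod.stdAddChar (-((x - y) * k)) * ZMod.stdAddChar (-(y * k)) := by
    rw [← AddChar.map_add_eq_mul]
    congr 1
    ring
  simp only [Equiv.subRight_apply, hchar]
  ring

theorem dft_cycleConvPow {N : ℕ} [NeZero N] (μ : ZMod N → ℝ) (n : ℕ) (k : ZMod N) :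
    ZMod.dft (fun x => (cycleConvPow μ n x : ℂ)) k =
      ZMod.dft (fun x => (μ x : ℂ)) k ^ n := by
  induction n with
  | zero => simp [ZMod.dft_apply, cycleConvPow, apply_ite Complex.ofReal]
  | succ n ih => rw [cycleConvPow, dft_cycleConv, ih, pow_succ']

/-- The variance identity for a unimodular function under a probability distribution. -/
theorem sum_mul_normSq_sub_mean {ι : Type*} [Fintype ι] (μ : ι → ℝ) (hsum : ∑ x, μ x = 1)
    (f : ι → ℂ) (hf : ∀ x, ‖f x‖ = 1) :
    ∑ x, μ x * Complex.normSq (f x - ∑ y, μ y * f y) =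
      1 - Complex.normSq (∑ y, μ y * f y) := by
  set S := ∑ y, (μ y : ℂ) * f y with hS
  have hre : ∑ x, μ x * (f x).re = S.re := by simp [hS]
  have him : ∑ x, μ x * (f x).im = S.im := by simp [hS]
  have hterm (x : ι) : μ x * Complex.normSq (f x - S) =
      μ x * (1 + Complex.normSq S) - 2 * S.re * (μ x * (f x).re)
        - 2 * S.im * (μ x * (f x).im) := by
    have h : Complex.normSq (f x) = 1 := by rw [Complex.normSq_eq_norm_sq, hf, one_pow]
    simp only [Complex.normSq_apply, Complex.sub_re, Complex.sub_im] at h ⊢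
    linear_combination μ x * h
  simp only [hterm]
  rw [Finset.sum_sub_distrib, Finset.sum_sub_distrib, ← Finset.sum_mul, ← Finset.mul_sum,
    ← Finset.mul_sum, hre, him, hsum, Complex.normSq_apply]
  ring

/-- If a mean of unimodular numbers has norm at least one, the numbers agree on the support. -/
theorem eq_mean_of_one_le_norm_mean {ι : Type*} [Fintype ι] (μ : ι → ℝ) (hpos : ∀ x, 0 ≤ μ x)
    (hsum : ∑ x, μ x = 1) (f : ι → ℂ) (hf : ∀ x, ‖f x‖ = 1)
    (hmean : 1 ≤ ‖∑ y, μ y * f y‖) {x : ι} (hx : μ x ≠ 0) : f x = ∑ y, μ y * f y := by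
  have hnonneg (y : ι) : 0 ≤ μ y * Complex.normSq (f y - ∑ z, μ z * f z) :=
    mul_nonneg (hpos y) (Complex.normSq_nonneg _)
  have hle := Finset.single_le_sum (fun y _ => hnonneg y) (Finset.mem_univ x)
  rw [sum_mul_normSq_sub_mean μ hsum f hf, Complex.normSq_eq_norm_sq (∑ y, μ y * f y)] at hle
  have hzero : μ x * Complex.normSq (f x - ∑ z, μ z * f z) = 0 :=
    le_antisymm (by nlinarith) (hnonneg x)
  exact sub_eq_zero.1 (Complex.normSq_eq_zero.1 ((mul_eq_zero.1 hzero).resolve_left hx))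

theorem norm_dft_lt_one {N : ℕ} [NeZero N] (μ : ZMod N → ℝ)
    (hpos : ∀ x, 0 ≤ μ x) (hsum : ∑ x : ZMod N, μ x = 1)
    (hsupp : ¬ ∃ (a : ZMod N) (H : AddSubgroup (ZMod N)), H ≠ ⊤ ∧
      ∀ x : ZMod N, μ x ≠ 0 → x - a ∈ H) {k : ZMod N} (hk : k ≠ 0) :
    ‖ZMod.dft (fun x => (μ x : ℂ)) k‖ < 1 := by
  by_contra! hge
  have hdft : ZMod.dft (fun x => (μ x : ℂ)) k =
      ∑ x, (μ x : ℂ) * ZMod.stdAddChar (-(x * k)) := by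
    simp only [ZMod.dft_apply, smul_eq_mul, mul_comm]
  rw [hdft] at hge
  have hconst {x : ZMod N} (hx : μ x ≠ 0) :=
    eq_mean_of_one_le_norm_mean μ hpos hsum (fun x => ZMod.stdAddChar (-(x * k)))
      (fun x => AddChar.norm_apply _ _) hge hx
  obtain ⟨a, ha⟩ : ∃ a, μ a ≠ 0 := by
    by_contra! h
    simp [h] at hsum
  refine hsupp ⟨a, (AddMonoidHom.mulRight k).ker, fun htop => hk ?_, fun x hx => ?_⟩
  · have h1 : (1 : ZMod N) ∈ (AddMonoidHom.mulRight k).ker := htop ▸ AddSubgroup.mem_top _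
    simpa using h1
  · have h := ZMod.injective_stdAddChar ((hconst hx).trans (hconst ha).symm)
    rw [AddMonoidHom.mem_ker, AddMonoidHom.mulRight_apply, sub_mul, neg_injective h, sub_self]

theorem cycleConvPow_eq_sum_dft {N : ℕ} [NeZero N] (μ : ZMod N → ℝ) (n : ℕ) (x : ZMod N) :
    (cycleConvPow μ n x : ℂ) = (N : ℂ)⁻¹ *
      ∑ k, ZMod.stdAddChar (k * x) * ZMod.dft (fun y => (μ y : ℂ)) k ^ n := by
  have h := congrFun (ZMod.dft.symm_apply_apply fun y => (cycleConvPow μ n y : ℂ)) x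
  rw [ZMod.invDFT_apply] at h
  simpa only [dft_cycleConvPow, smul_eq_mul] using h.symm

/-- Ergodic theorem for random walks on the cycle (sufficiency): if the support of the
probability distribution `μ` on `ZMod N` is not contained in any coset of a proper subgroup
of `ZMod N`, then the `n`-fold convolution powers of `μ` converge pointwise to the uniform
distribution `1/N`. -/
theorem cycle_random_walk_ergodic_of_support_not_in_coset
    (N : ℕ) [NeZero N] (hN : 1 ≤ N) (μ : ZMod N → ℝ)
    (hpos : ∀ x, 0 ≤ μ x) (hsum : ∑ x : ZMod N, μ x = 1)
    (hsupp : ¬ ∃ (a : ZMod N) (H : AddSubgroup (ZMod N)), H ≠ ⊤ ∧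
      ∀ x : ZMod N, μ x ≠ 0 → x - a ∈ H) :
    ∀ x : ZMod N,
      Tendsto (fun n : ℕ => cycleConvPow μ n x) atTop (nhds (1 / (N : ℝ))) := by
  intro x
  have hzero : ZMod.dft (fun y => (μ y : ℂ)) 0 = 1 := by
    rw [ZMod.dft_apply_zero]
    exact_mod_cast hsum
  have hlim : Tendsto (fun n : ℕ => (cycleConvPow μ n x : ℂ)) atTop
      (nhds ((N : ℂ)⁻¹ * ∑ k : ZMod N, if k = 0 then 1 else 0)) := by
    simp only [cycleConvPow_eq_sum_dft]
    refine (tendsto_finsetSum _ fun k _ => ?_).const_mul _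
    split_ifs with hk
    · simp [hk, hzero]
    · simpa using (tendsto_pow_atTop_nhds_zero_of_norm_lt_one
        (norm_dft_lt_one μ hpos hsum hsupp hk)).const_mul (ZMod.stdAddChar (k * x))
  simpa [Function.comp_def] using (Complex.continuous_re.tendsto _).comp hlim
end

section
/- Ergodic theorem for random walks on the cycle, necessity: let N ≥ 2 and let μ be a probability distribution on ZMod N whose support is contained in some coset a + H of a proper subgroup H of ZMod N. Then the convolution powers of μ do not converge pointwise to the uniform distribution: it is not the case that for every x ∈ ZMod N, μ^{⋆n}(x) → 1/N as n → ∞. -/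
open Filter

/-- Fourier coefficient of `μ : ZMod N → ℝ`:
`μ̂(k) = ∑ s, μ(s) · exp(−2πi · k.val · s.val / N)`. -/
noncomputable def cycleFourier {N : ℕ} [NeZero N] (μ : ZMod N → ℝ) (k : ZMod N) : ℂ :=
  ∑ s : ZMod N, (μ s : ℂ) *
    Complex.exp (-(2 * (Real.pi : ℂ) * Complex.I * (k.val : ℂ) * (s.val : ℂ)) / (N : ℂ))

/-- Shannon entropy (base 2) of a distribution on `ZMod N`, with `0 · log₂ 0 = 0`
(automatic since `Real.logb 2 0 = 0`). -/
noncomputable def shannonEntropy {N : ℕ} [NeZero N] (p : ZMod N → ℝ) : ℝ :=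
  -∑ x : ZMod N, p x * Real.logb 2 (p x)

/-- If `μ` is supported in the coset `a + H`, then `μ^{⋆n}` is supported in `n • a + H`. -/
theorem sub_nsmul_mem_of_cycleConvPow_ne_zero {N : ℕ} [NeZero N] {μ : ZMod N → ℝ} {a : ZMod N}
    {H : AddSubgroup (ZMod N)} (hsupp : ∀ x : ZMod N, μ x ≠ 0 → x - a ∈ H) {n : ℕ} {x : ZMod N}
    (hx : cycleConvPow μ n x ≠ 0) : x - n • a ∈ H := by
  induction n generalizing x with
  | zero =>
    have h0 : x = 0 := by simpa [cycleConvPow] using hx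
    simp [h0, H.zero_mem]
  | succ n ih =>
    obtain ⟨y, -, hy⟩ := Finset.exists_ne_zero_of_sum_ne_zero hx
    have hadd := H.add_mem (hsupp _ (left_ne_zero_of_mul hy)) (ih (right_ne_zero_of_mul hy))
    convert hadd using 1
    rw [succ_nsmul]
    abel

/-- Ergodic theorem for random walks on the cycle (necessity): if the support of the
probability distribution `μ` on `ZMod N` (with `N ≥ 2`) is contained in a coset `a + H`
of a proper subgroup `H` of `ZMod N`, then the convolution powers of `μ` do not converge
pointwise to the uniform distribution. -/
theorem cycle_random_walk_not_ergodic_of_support_in_coset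
    (N : ℕ) [NeZero N] (hN : 2 ≤ N) (μ : ZMod N → ℝ)
    (hpos : ∀ x, 0 ≤ μ x) (hsum : ∑ x : ZMod N, μ x = 1)
    (a : ZMod N) (H : AddSubgroup (ZMod N)) (hH : H ≠ ⊤)
    (hsupp : ∀ x : ZMod N, μ x ≠ 0 → x - a ∈ H) :
    ¬ (∀ x : ZMod N,
        Tendsto (fun n : ℕ => cycleConvPow μ n x) atTop (nhds (1 / (N : ℝ)))) := by
  intro hlim
  obtain ⟨x, hx⟩ : ∃ x, x ∉ H := by
    by_contra! h
    exact hH ((AddSubgroup.eq_top_iff' H).2 h)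
  have hmul : Tendsto (fun m : ℕ => N * m) atTop atTop :=
    tendsto_id.const_mul_atTop' (NeZero.pos N)
  have hzero (m : ℕ) : cycleConvPow μ (N * m) x = 0 := by
    by_contra h
    exact hx (by simpa using sub_nsmul_mem_of_cycleConvPow_ne_zero hsupp h)
  have hsub := (hlim x).comp hmul
  simp only [Function.comp_def, hzero] at hsub
  have hinv : (0 : ℝ) = 1 / N := tendsto_nhds_unique tendsto_const_nhds hsub
  exact one_div_ne_zero (Nat.cast_ne_zero.2 (NeZero.ne N)) hinv.symm
end

section
/- Let N ≥ 1 and let μ be a probability distribution on ZMod N whose support is not contained in any coset of a proper subgroup of ZMod N. Then for every k ∈ ZMod N with k ≠ 0, the Fourier coefficient satisfies |μ̂(k)| < 1. -/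
open Filter

/-- Each exponential in `cycleFourier` is a value of the standard additive character. -/
theorem exp_eq_stdAddChar {N : ℕ} [NeZero N] (k s : ZMod N) :
    Complex.exp (-(2 * (Real.pi : ℂ) * Complex.I * (k.val : ℂ) * (s.val : ℂ)) / (N : ℂ)) =
      ZMod.stdAddChar (-(k * s)) := by
  have h := ZMod.stdAddChar_coe (N := N) (-((k.val : ℤ) * (s.val : ℤ)))
  push_cast [ZMod.natCast_zmod_val] at h
  rw [h]
  ring_nf

theorem cycleFourier_eq_sum_smul {N : ℕ} [NeZero N] (μ : ZMod N → ℝ) (k : ZMod N) :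
    cycleFourier μ k = ∑ s : ZMod N, μ s • (ZMod.stdAddChar (-(k * s)) : ℂ) := by
  simp only [cycleFourier, exp_eq_stdAddChar, Complex.real_smul]

/-- If the support of the probability distribution `μ` on `ZMod N` is not contained in any
coset of a proper subgroup of `ZMod N`, then every nonzero Fourier coefficient of `μ`
has modulus strictly less than 1. -/
theorem fourier_coeff_lt_one_of_support_not_in_coset
    (N : ℕ) [NeZero N] (hN : 1 ≤ N) (μ : ZMod N → ℝ)
    (hpos : ∀ x, 0 ≤ μ x) (hsum : ∑ x : ZMod N, μ x = 1)
    (hsupp : ¬ ∃ (a : ZMod N) (H : AddSubgroup (ZMod N)), H ≠ ⊤ ∧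
      ∀ x : ZMod N, μ x ≠ 0 → x - a ∈ H) :
    ∀ k : ZMod N, k ≠ 0 → ‖cycleFourier μ k‖ < 1 := by
  intro k hk
  by_contra hlt
  obtain ⟨a, -, ha⟩ : ∃ a ∈ Finset.univ, μ a ≠ 0 :=
    Finset.exists_ne_zero_of_sum_ne_zero (by rw [hsum]; exact one_ne_zero)
  refine hsupp ⟨a, (AddMonoidHom.mulLeft k).ker, fun htop => hk ?_, fun x hx => ?_⟩
  · have h1 : (1 : ZMod N) ∈ (AddMonoidHom.mulLeft k).ker := htop ▸ AddSubgroup.mem_top 1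
    simpa [AddMonoidHom.mem_ker] using h1
  · by_contra hxa
    have hne : (ZMod.stdAddChar (-(k * x)) : ℂ) ≠ ZMod.stdAddChar (-(k * a)) := fun h =>
      hxa (by
        have h2 := neg_injective (ZMod.injective_stdAddChar h)
        simp [AddMonoidHom.mem_ker, mul_sub, h2])
    apply hlt
    rw [cycleFourier_eq_sum_smul]
    exact norm_sum_lt_of_strictConvexSpace (fun i _ => hpos i) hsum (Finset.mem_univ x)
      (Finset.mem_univ a) hne hx ha (fun i _ => (AddChar.norm_apply _ _).le)
end

section
/- Upper bound lemma (Diaconis–Shahshahani): let N ≥ 1 and let μ be a probability distribution on ZMod N. Then for every n ≥ 1, the ℓ¹ distance of the n-fold convolution power from the uniform distribution satisfies ∑_{x ∈ ZMod N} |μ^{⋆n}(x) − 1/N| ≤ √( ∑_{k ≠ 0} |μ̂(k)|^{2n} ). -/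
open Filter

open scoped ZMod in
theorem cycleFourier_eq_dft {N : ℕ} [NeZero N] (μ : ZMod N → ℝ) (k : ZMod N) :
    cycleFourier μ k = 𝓕 (fun s => (μ s : ℂ)) k := by
  rw [ZMod.dft_apply]
  refine Finset.sum_congr rfl fun s _ => ?_
  have h : -(s * k) = ((-(s.val * k.val : ℤ) : ℤ) : ZMod N) := by simp
  rw [h, ZMod.stdAddChar_coe, smul_eq_mul, mul_comm]
  congr 2
  push_cast
  ring

theorem cycleFourier_eq_sum_stdAddChar {N : ℕ} [NeZero N] (μ : ZMod N → ℝ) (k : ZMod N) :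
    cycleFourier μ k = ∑ s, ZMod.stdAddChar (-(s * k)) * (μ s : ℂ) := by
  simp [cycleFourier_eq_dft, ZMod.dft_apply]

open scoped ZMod ComplexConjugate in
/-- Parseval's identity for the discrete Fourier transform. -/
theorem sum_sq_norm_dft {N : ℕ} [NeZero N] (f : ZMod N → ℂ) :
    ∑ k, ‖𝓕 f k‖ ^ 2 = N * ∑ s, ‖f s‖ ^ 2 := by
  have hconj : ∀ k, conj (𝓕 f k) = ∑ s, ZMod.stdAddChar (s * k) * conj (f s) := fun k => by
    rw [ZMod.dft_apply, map_sum]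
    refine Finset.sum_congr rfl fun s _ => ?_
    rw [smul_eq_mul, map_mul, ← AddChar.map_neg_eq_conj, neg_neg]
  have hinv : ∀ s, ∑ k, ZMod.stdAddChar (s * k) * 𝓕 f k = N * f s := fun s => by
    have h := congrFun (ZMod.dft_dft f) (-s)
    simpa [ZMod.dft_apply (𝓕 f), mul_comm s] using h
  have key : ∑ k, conj (𝓕 f k) * 𝓕 f k = N * ∑ s, conj (f s) * f s := by
    simp_rw [hconj, Finset.sum_mul]
    rw [Finset.sum_comm, Finset.mul_sum]
    refine Finset.sum_congr rfl fun s _ => ?_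
    rw [mul_left_comm, ← hinv, Finset.mul_sum]
    exact Finset.sum_congr rfl fun k _ => by ring
  simp_rw [Complex.conj_mul'] at key
  exact_mod_cast key

theorem sum_sq_norm_cycleFourier {N : ℕ} [NeZero N] (f : ZMod N → ℝ) :
    ∑ k, ‖cycleFourier f k‖ ^ 2 = N * ∑ s, f s ^ 2 := by
  simp_rw [cycleFourier_eq_dft, sum_sq_norm_dft, Complex.norm_real, Real.norm_eq_abs, sq_abs]

theorem cycleFourier_cycleConv {N : ℕ} [NeZero N] (μ ν : ZMod N → ℝ) (k : ZMod N) :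
    cycleFourier (cycleConv μ ν) k = cycleFourier μ k * cycleFourier ν k := by
  simp_rw [cycleFourier_eq_sum_stdAddChar, cycleConv, Complex.ofReal_sum, Finset.mul_sum]
  rw [Finset.sum_comm]
  refine Finset.sum_congr rfl fun y _ => ?_
  rw [Finset.sum_mul, ← Equiv.sum_comp (Equiv.addRight y)]
  refine Finset.sum_congr rfl fun x _ => ?_
  rw [Equiv.coe_addRight, add_sub_cancel_right, add_mul, neg_add, AddChar.map_add_eq_mul,
    Complex.ofReal_mul]
  ring

theorem cycleFourier_cycleConvPow {N : ℕ} [NeZero N] (μ : ZMod N → ℝ) (n : ℕ) (k : ZMod N) :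
    cycleFourier (cycleConvPow μ n) k = cycleFourier μ k ^ n := by
  induction n with
  | zero => simp [cycleFourier_eq_sum_stdAddChar, cycleConvPow, apply_ite Complex.ofReal]
  | succ n ih => rw [cycleConvPow, cycleFourier_cycleConv, ih, pow_succ']

theorem cycleFourier_zero {N : ℕ} [NeZero N] (μ : ZMod N → ℝ) :
    cycleFourier μ 0 = ∑ s, (μ s : ℂ) := by
  simp [cycleFourier]

theorem cycleFourier_sub_uniform {N : ℕ} [NeZero N] (μ : ZMod N → ℝ) (k : ZMod N) :
    cycleFourier (fun x => μ x - 1 / (N : ℝ)) k = cycleFourier μ k - if k = 0 then 1 else 0 := by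
  have h : ∑ s : ZMod N, ZMod.stdAddChar (-(s * k)) = if k = 0 then (N : ℂ) else 0 := by
    simpa using AddChar.sum_mulShift (-k) (ZMod.isPrimitive_stdAddChar N)
  have hN : (N : ℂ) ≠ 0 := NeZero.ne _
  simp_rw [cycleFourier_eq_sum_stdAddChar, Complex.ofReal_sub, mul_sub, Finset.sum_sub_distrib,
    ← Finset.sum_mul, h]
  split_ifs <;> simp [hN]

/-- Upper bound lemma (Diaconis–Shahshahani): the ℓ¹ distance of the `n`-fold convolution
power of `μ` from the uniform distribution is bounded by
`√( ∑_{k ≠ 0} |μ̂(k)|^{2n} )`. -/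
theorem diaconis_shahshahani_upper_bound
    (N : ℕ) [NeZero N] (hN : 1 ≤ N) (μ : ZMod N → ℝ)
    (hpos : ∀ x, 0 ≤ μ x) (hsum : ∑ x : ZMod N, μ x = 1)
    (n : ℕ) (hn : 1 ≤ n) :
    ∑ x : ZMod N, |cycleConvPow μ n x - 1 / (N : ℝ)| ≤
      Real.sqrt (∑ k ∈ Finset.univ.filter (fun k : ZMod N => k ≠ 0),
        ‖cycleFourier μ k‖ ^ (2 * n)) := by
  have hF0 : cycleFourier μ 0 = 1 := by
    rw [cycleFourier_zero, ← Complex.ofReal_sum, hsum, Complex.ofReal_one]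
  refine Real.le_sqrt_of_sq_le ?_
  calc (∑ x : ZMod N, |cycleConvPow μ n x - 1 / (N : ℝ)|) ^ 2
      ≤ N * ∑ x : ZMod N, (cycleConvPow μ n x - 1 / (N : ℝ)) ^ 2 := by
        simpa using sq_sum_le_card_mul_sum_sq (s := Finset.univ)
          (f := fun x : ZMod N => |cycleConvPow μ n x - 1 / (N : ℝ)|)
    _ = ∑ k : ZMod N, ‖cycleFourier μ k ^ n - if k = 0 then 1 else 0‖ ^ 2 := by
        simp_rw [← sum_sq_norm_cycleFourier, cycleFourier_sub_uniform, cycleFourier_cycleConvPow]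
    _ = ∑ k ∈ Finset.univ.filter (fun k : ZMod N => k ≠ 0), ‖cycleFourier μ k‖ ^ (2 * n) := by
        rw [Finset.sum_filter]
        refine Finset.sum_congr rfl fun k _ => ?_
        by_cases hk : k = 0
        · simp [hk, hF0]
        · simp [hk, pow_mul']
end

section
/- Non-uniformity of the Cesàro distribution for the coin (I + iσ₁)/√2: let N ≥ 3 be odd and consider the DTQW on the N-cycle with coin operator C = (1/√2)·[[1, i],[i, 1]], initial coin state c₀ = (|↑⟩ + |↓⟩)/√2 and initial position |0⟩. Then the time-averaged distribution does not converge to the uniform distribution: there exists a vertex v ∈ ZMod N such that p̄_T(v) does not tend to 1/N as T → ∞. -/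
open Filter

/-- The unbiased coin operator `C = (I + i σ₁)/√2 = (1/√2)·[[1, i],[i, 1]]`. -/
noncomputable def coinC : Matrix (Fin 2) (Fin 2) ℂ :=
  ((Real.sqrt 2 : ℂ))⁻¹ • !![1, Complex.I; Complex.I, 1]

/-- Action of a coin matrix on a walker state `ψ : Fin 2 × ZMod N → ℂ` (i.e. `C ⊗ I`). -/
noncomputable def applyCoin {N : ℕ} (C : Matrix (Fin 2) (Fin 2) ℂ)
    (ψ : Fin 2 × ZMod N → ℂ) : Fin 2 × ZMod N → ℂ :=
  fun p => ∑ c : Fin 2, C p.1 c * ψ (c, p.2)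

/-- The conditional shift `S = |↑⟩⟨↑| ⊗ ∑_x |x+1⟩⟨x| + |↓⟩⟨↓| ⊗ ∑_x |x−1⟩⟨x|`
(with `↑ = 0`, `↓ = 1` in `Fin 2`), acting on states `ψ : Fin 2 × ZMod N → ℂ`. -/
def shiftOp {N : ℕ} (ψ : Fin 2 × ZMod N → ℂ) : Fin 2 × ZMod N → ℂ :=
  fun p => if p.1 = 0 then ψ (p.1, p.2 - 1) else ψ (p.1, p.2 + 1)

/-- The one-step DTQW operator `U = S·(C ⊗ I)` on the `N`-cycle, for coin matrix `C`. -/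
noncomputable def qwStep {N : ℕ} (C : Matrix (Fin 2) (Fin 2) ℂ)
    (ψ : Fin 2 × ZMod N → ℂ) : Fin 2 × ZMod N → ℂ :=
  shiftOp (applyCoin C ψ)

/-- The initial coin state `c₀ = (|↑⟩ + |↓⟩)/√2`. -/
noncomputable def coin0 : Fin 2 → ℂ := fun _ => ((Real.sqrt 2 : ℂ))⁻¹

/-- Product initial state `γ ⊗ |y⟩` of coin state `γ` and the position state
localized at `y`. -/
def initState {N : ℕ} (γ : Fin 2 → ℂ) (y : ZMod N) : Fin 2 × ZMod N → ℂ :=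
  fun p => γ p.1 * (if p.2 = y then 1 else 0)

/-- `m`-step transition probability `p_m(x|y) = ∑_c |⟨c, x| U^m |c₀ ⊗ y⟩|²` of the DTQW
with coin matrix `C` on the `N`-cycle, starting from coin state `c₀` at site `y`. -/
noncomputable def transProb (N : ℕ) (C : Matrix (Fin 2) (Fin 2) ℂ) (m : ℕ)
    (x y : ZMod N) : ℝ :=
  ∑ c : Fin 2, ‖(qwStep C)^[m] (initState coin0 y) (c, x)‖ ^ 2

/-- Position distribution at time `t` of the DTQW with coin `C`, initial state `ψ₀`. -/
noncomputable def posDist {N : ℕ} (C : Matrix (Fin 2) (Fin 2) ℂ)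
    (ψ₀ : Fin 2 × ZMod N → ℂ) (t : ℕ) (v : ZMod N) : ℝ :=
  ∑ c : Fin 2, ‖(qwStep C)^[t] ψ₀ (c, v)‖ ^ 2

/-- Time-averaged (Cesàro) distribution `p̄_T(v) = (1/T) ∑_{t=0}^{T−1} p_t(v)`. -/
noncomputable def cesaroDist {N : ℕ} (C : Matrix (Fin 2) (Fin 2) ℂ)
    (ψ₀ : Fin 2 × ZMod N → ℂ) (T : ℕ) (v : ZMod N) : ℝ :=
  (1 / (T : ℝ)) * ∑ t ∈ Finset.range T, posDist C ψ₀ t v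

open scoped ComplexConjugate

/-- The amplitude at time `t` of the momentum mode whose character value is `z`. -/
noncomputable def modeAmp (z : ℂ) : ℕ → Fin 2 → ℂ
  | 0 => coin0
  | t + 1 =>
    ![(Real.sqrt 2 : ℂ)⁻¹ * conj z * (modeAmp z t 0 + Complex.I * modeAmp z t 1),
      (Real.sqrt 2 : ℂ)⁻¹ * z * (Complex.I * modeAmp z t 0 + modeAmp z t 1)]

/-- The inner product of two momentum modes at time `t`. -/
noncomputable def modeOverlap (y z : ℂ) (t : ℕ) : ℂ :=
  ∑ c : Fin 2, conj (modeAmp y t c) * modeAmp z t c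

/-- The trace of the one-step operator on the momentum mode `z` of modulus one. -/
noncomputable def modeTrace (z : ℂ) : ℝ := Real.sqrt 2 * z.re

theorem inv_sqrt_two_sq : ((Real.sqrt 2 : ℂ)⁻¹) ^ 2 = 1 / 2 := by
  rw [inv_pow, ← Complex.ofReal_pow, Real.sq_sqrt zero_le_two]
  norm_num

theorem conj_inv_sqrt_two : conj ((Real.sqrt 2 : ℂ)⁻¹) = (Real.sqrt 2 : ℂ)⁻¹ := by
  rw [map_inv₀, Complex.conj_ofReal]

theorem ofReal_modeTrace (z : ℂ) :
    (modeTrace z : ℂ) = (Real.sqrt 2 : ℂ)⁻¹ * (z + conj z) := by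
  have h2 : (Real.sqrt 2 : ℂ) ≠ 0 := by simp
  have h : (Real.sqrt 2 : ℂ) = 2 * (Real.sqrt 2 : ℂ)⁻¹ := by
    field_simp
    rw [← Complex.ofReal_pow, Real.sq_sqrt zero_le_two]
    norm_num
  rw [modeTrace, Complex.add_conj]
  push_cast
  nth_rewrite 1 [h]
  ring

theorem mul_conj_of_norm_eq_one {z : ℂ} (hz : ‖z‖ = 1) : z * conj z = 1 := by
  rw [Complex.mul_conj']
  simp [hz]

theorem modeAmp_add_two {z : ℂ} (hz : ‖z‖ = 1) (t : ℕ) (c : Fin 2) :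
    modeAmp z (t + 2) c = modeTrace z * modeAmp z (t + 1) c - modeAmp z t c := by
  have hr := inv_sqrt_two_sq
  have hz' := mul_conj_of_norm_eq_one hz
  have hI := Complex.I_sq
  rw [ofReal_modeTrace]
  fin_cases c
  · simp only [modeAmp, Fin.zero_eta, Matrix.cons_val_zero, Matrix.cons_val_one]
    generalize (Real.sqrt 2 : ℂ)⁻¹ = r at *
    linear_combination r ^ 2 * z * conj z * modeAmp z t 0 * hI
      - 2 * r ^ 2 * modeAmp z t 0 * hz' - 2 * modeAmp z t 0 * hr
  · simp only [modeAmp, Fin.mk_one, Matrix.cons_val_zero, Matrix.cons_val_one]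
    generalize (Real.sqrt 2 : ℂ)⁻¹ = r at *
    linear_combination r ^ 2 * z * conj z * modeAmp z t 1 * hI
      - 2 * r ^ 2 * modeAmp z t 1 * hz' - 2 * modeAmp z t 1 * hr

theorem conj_modeAmp_add_two {z : ℂ} (hz : ‖z‖ = 1) (t : ℕ) (c : Fin 2) :
    conj (modeAmp z (t + 2) c) =
      modeTrace z * conj (modeAmp z (t + 1) c) - conj (modeAmp z t c) := by
  rw [modeAmp_add_two hz, map_sub, map_mul, Complex.conj_ofReal]

theorem modeOverlap_self {z : ℂ} (hz : ‖z‖ = 1) (t : ℕ) : modeOverlap z z t = 1 := by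
  have hr := inv_sqrt_two_sq
  have hz' := mul_conj_of_norm_eq_one hz
  have hI := Complex.I_sq
  have hc := conj_inv_sqrt_two
  induction t with
  | zero =>
    simp only [modeOverlap, modeAmp, coin0, hc, Fin.sum_univ_two]
    linear_combination 2 * hr
  | succ t ih =>
    simp only [modeOverlap, Fin.sum_univ_two] at ih
    simp only [modeOverlap, modeAmp, Fin.sum_univ_two, Matrix.cons_val_zero, Matrix.cons_val_one,
      map_mul, map_add, hc, Complex.conj_conj, Complex.conj_I]
    generalize (Real.sqrt 2 : ℂ)⁻¹ = r at *
    generalize conj (modeAmp z t 0) = u' at *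
    generalize conj (modeAmp z t 1) = d' at *
    generalize modeAmp z t 0 = u at *
    generalize modeAmp z t 1 = d at *
    generalize conj z = w at *
    linear_combination -r ^ 2 * z * w * (u' * u + d' * d) * hI
      + 2 * r ^ 2 * (u' * u + d' * d) * hz' + 2 * (u' * u + d' * d) * hr + ih

theorem norm_modeOverlap_le {y z : ℂ} (hy : ‖y‖ = 1) (hz : ‖z‖ = 1) (t : ℕ) :
    ‖modeOverlap y z t‖ ≤ 2 := by
  have h : ∀ {z : ℂ}, ‖z‖ = 1 → ∀ c, ‖modeAmp z t c‖ ≤ 1 := by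
    intro z hz c
    have h1 := modeOverlap_self hz t
    simp only [modeOverlap, Complex.conj_mul', Fin.sum_univ_two] at h1
    norm_cast at h1
    fin_cases c
    · simp only [Fin.zero_eta]
      nlinarith [sq_nonneg ‖modeAmp z t 1‖, norm_nonneg (modeAmp z t 0)]
    · simp only [Fin.mk_one]
      nlinarith [sq_nonneg ‖modeAmp z t 0‖, norm_nonneg (modeAmp z t 1)]
  have hc : ∀ c : Fin 2, ‖conj (modeAmp y t c) * modeAmp z t c‖ ≤ 1 := fun c => by
    rw [norm_mul, Complex.norm_conj]
    exact mul_le_one₀ (h hy c) (norm_nonneg _) (h hz c)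
  calc ‖modeOverlap y z t‖ ≤ ∑ c : Fin 2, ‖conj (modeAmp y t c) * modeAmp z t c‖ :=
        norm_sum_le _ _
    _ ≤ ∑ _c : Fin 2, (1 : ℝ) := Finset.sum_le_sum fun c _ => hc c
    _ = 2 := by simp

/-- A sequence that is constant up to a bounded coboundary has that constant as Cesàro limit. -/
theorem tendsto_cesaro_of_coboundary {s G : ℕ → ℂ} {a q : ℂ} {B : ℝ} (ha : a ≠ 0)
    (hG : ∀ t, ‖G t‖ ≤ B) (h : ∀ t, a * s t = q - (G (t + 1) - G t)) :
    Tendsto (fun T : ℕ => (T : ℂ)⁻¹ * ∑ t ∈ Finset.range T, s t) atTop (nhds (q / a)) := by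
  have hsum : ∀ T : ℕ, a * ∑ t ∈ Finset.range T, s t = T * q - (G T - G 0) := fun T => by
    rw [Finset.mul_sum, Finset.sum_congr rfl fun t _ => h t, Finset.sum_sub_distrib,
      Finset.sum_range_sub, Finset.sum_const, Finset.card_range, nsmul_eq_mul]
  have h0 : Tendsto (fun T : ℕ => (T : ℂ)⁻¹ * (G T - G 0)) atTop (nhds 0) := by
    refine squeeze_zero_norm (a := fun T : ℕ => (T : ℝ)⁻¹ * (B + B)) (fun T => ?_) ?_
    · rw [norm_mul, norm_inv, Complex.norm_natCast]
      gcongr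
      exact (norm_sub_le _ _).trans (add_le_add (hG _) (hG _))
    · simpa using (tendsto_inv_atTop_nhds_zero_nat (𝕜 := ℝ)).mul_const (B + B)
  have h1 : Tendsto (fun T : ℕ => q / a - (T : ℂ)⁻¹ * (G T - G 0) / a) atTop (nhds (q / a)) := by
    simpa using (tendsto_const_nhds (x := q / a)).sub (h0.div_const a)
  refine h1.congr' ?_
  filter_upwards [eventually_gt_atTop 0] with T hT
  have hT' : (T : ℂ) ≠ 0 := by exact_mod_cast hT.ne'
  field_simp
  linear_combination -hsum T

theorem tendsto_cesaro_modeOverlap_zero {y z : ℂ} (hy : ‖y‖ = 1) (hz : ‖z‖ = 1)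
    (h : modeTrace y ≠ modeTrace z) :
    Tendsto (fun T : ℕ => (T : ℂ)⁻¹ * ∑ t ∈ Finset.range T, modeOverlap y z t) atTop
      (nhds 0) := by
  have hab : ((modeTrace y : ℂ) - modeTrace z) ^ 2 ≠ 0 :=
    pow_ne_zero _ (sub_ne_zero.2 (Complex.ofReal_injective.ne h))
  have hs := norm_modeOverlap_le hy hz
  have hy2 := conj_modeAmp_add_two hy
  have hz2 := modeAmp_add_two hz
  generalize (modeTrace y : ℂ) = a at *
  generalize (modeTrace z : ℂ) = b at *
  rw [← zero_div ((a - b) ^ 2)]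
  refine tendsto_cesaro_of_coboundary (B := 2 + ‖1 - a * b‖ * 2 + ‖a ^ 2 + b ^ 2 - 1 - a * b‖ * 2
      + ‖(a - b) ^ 2 - 1‖ * 2)
    (G := fun t => modeOverlap y z (t + 3) + (1 - a * b) * modeOverlap y z (t + 2)
      + (a ^ 2 + b ^ 2 - 1 - a * b) * modeOverlap y z (t + 1)
      + ((a - b) ^ 2 - 1) * modeOverlap y z t) hab (fun t => ?_) fun t => ?_
  · refine (norm_add_le _ _).trans (add_le_add ((norm_add_le _ _).trans
      (add_le_add ((norm_add_le _ _).trans (add_le_add (hs _) ?_)) ?_)) ?_) <;>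
    · rw [norm_mul]
      gcongr
      exact hs _
  · simp only [modeOverlap, Fin.sum_univ_two, hy2, hz2]
    ring

theorem modeTrace_conj (z : ℂ) : modeTrace (conj z) = modeTrace z := by
  simp [modeTrace]

theorem modeTrace_sq_lt {z : ℂ} (hz : ‖z‖ = 1) : modeTrace z ^ 2 < 4 := by
  have h := Complex.sq_norm_sub_sq_im z
  rw [modeTrace, mul_pow, Real.sq_sqrt zero_le_two]
  nlinarith [sq_nonneg z.im]

theorem modeOverlap_conj_conserved {z : ℂ} (hz : ‖z‖ = 1) (t : ℕ) :
    modeOverlap (conj z) z (t + 2) - (modeTrace z ^ 2 - 2) * modeOverlap (conj z) z (t + 1)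
      + modeOverlap (conj z) z t = modeTrace z ^ 2 := by
  have hy2 := conj_modeAmp_add_two (z := conj z) (by rwa [Complex.norm_conj])
  have hz2 := modeAmp_add_two hz
  rw [modeTrace_conj] at hy2
  induction t with
  | zero =>
    have hr := inv_sqrt_two_sq
    have hz' := mul_conj_of_norm_eq_one hz
    have hI := Complex.I_sq
    have hc := conj_inv_sqrt_two
    have ha := ofReal_modeTrace z
    simp only [modeOverlap, Fin.sum_univ_two, hy2, hz2]
    simp only [modeAmp, coin0, Matrix.cons_val_zero, Matrix.cons_val_one,
      map_mul, map_add, hc, Complex.conj_conj, Complex.conj_I, ha]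
    generalize (Real.sqrt 2 : ℂ)⁻¹ = r at *
    generalize conj z = w at *
    linear_combination -2 * r ^ 4 * (z ^ 2 + w ^ 2) * hI
      + (2 * r ^ 2 * (z ^ 2 + w ^ 2) - 4 * r ^ 2) * hr - (4 * r ^ 4 + 2 * r ^ 2) * hz'
  | succ t ih =>
    refine Eq.trans ?_ ih
    simp only [modeOverlap, Fin.sum_univ_two, hy2, hz2]
    ring

theorem tendsto_cesaro_modeOverlap_conj {z : ℂ} (hz : ‖z‖ = 1) :
    Tendsto (fun T : ℕ => (T : ℂ)⁻¹ * ∑ t ∈ Finset.range T, modeOverlap (conj z) z t) atTop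
      (nhds (modeTrace z ^ 2 / (4 - modeTrace z ^ 2))) := by
  have ha : (4 - modeTrace z ^ 2 : ℂ) ≠ 0 := by
    have := modeTrace_sq_lt hz
    exact_mod_cast (sub_pos.2 this).ne'
  have hs := norm_modeOverlap_le (y := conj z) (by rwa [Complex.norm_conj]) hz
  have hq := modeOverlap_conj_conserved hz
  refine tendsto_cesaro_of_coboundary (B := 2 + ‖(3 - modeTrace z ^ 2 : ℂ)‖ * 2)
    (G := fun t => modeOverlap (conj z) z (t + 1)
      + (3 - modeTrace z ^ 2) * modeOverlap (conj z) z t) ha (fun t => ?_) fun t => ?_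
  · refine (norm_add_le _ _).trans (add_le_add (hs _) ?_)
    rw [norm_mul]
    gcongr
    exact hs _
  · linear_combination hq t

theorem norm_stdAddChar {N : ℕ} [NeZero N] (k : ZMod N) :
    ‖ZMod.stdAddChar k‖ = 1 := by
  simp

theorem conj_stdAddChar {N : ℕ} [NeZero N] (k : ZMod N) :
    conj (ZMod.stdAddChar k) = ZMod.stdAddChar (-k) := by
  exact (AddChar.map_neg_eq_conj _ _).symm

theorem eq_or_eq_neg_of_modeTrace_eq {N : ℕ} [NeZero N] {j k : ZMod N}
    (h : modeTrace (ZMod.stdAddChar j) = modeTrace (ZMod.stdAddChar k)) : j = k ∨ j = -k := by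
  have hj := mul_conj_of_norm_eq_one (norm_stdAddChar j)
  have hk := mul_conj_of_norm_eq_one (norm_stdAddChar k)
  have h' := congrArg (fun x : ℝ => (x : ℂ)) h
  simp only [ofReal_modeTrace] at h'
  have h2 : (Real.sqrt 2 : ℂ)⁻¹ ≠ 0 := by simp
  replace h' := mul_left_cancel₀ h2 h'
  have hp : (ZMod.stdAddChar j - ZMod.stdAddChar k : ℂ) *
      (ZMod.stdAddChar j - ZMod.stdAddChar (-k)) = 0 := by
    rw [← conj_stdAddChar]
    linear_combination ZMod.stdAddChar j * h' - hj + hk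
  rcases mul_eq_zero.1 hp with h | h
  · exact .inl (ZMod.injective_stdAddChar (sub_eq_zero.1 h))
  · exact .inr (ZMod.injective_stdAddChar (sub_eq_zero.1 h))

theorem qwStep_coinC_zero {N : ℕ} (ψ : Fin 2 × ZMod N → ℂ) (x : ZMod N) :
    qwStep coinC ψ (0, x) =
      (Real.sqrt 2 : ℂ)⁻¹ * (ψ (0, x - 1) + Complex.I * ψ (1, x - 1)) := by
  simp [qwStep, shiftOp, applyCoin, coinC]
  ring

theorem qwStep_coinC_one {N : ℕ} (ψ : Fin 2 × ZMod N → ℂ) (x : ZMod N) :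
    qwStep coinC ψ (1, x) =
      (Real.sqrt 2 : ℂ)⁻¹ * (Complex.I * ψ (0, x + 1) + ψ (1, x + 1)) := by
  simp [qwStep, shiftOp, applyCoin, coinC]
  ring

theorem qwStep_iterate_initState {N : ℕ} [NeZero N] (t : ℕ) (c : Fin 2) (x : ZMod N) :
    (qwStep coinC)^[t] (initState coin0 (0 : ZMod N)) (c, x) =
      (N : ℂ)⁻¹ * ∑ k : ZMod N, modeAmp (ZMod.stdAddChar k) t c * ZMod.stdAddChar (k * x) := by
  induction t generalizing c x with
  | zero =>
    have h := AddChar.sum_mulShift x (ZMod.isPrimitive_stdAddChar N)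
    have hN : (N : ℂ) ≠ 0 := NeZero.ne _
    simp only [Function.iterate_zero, id_eq, initState, modeAmp, ← Finset.mul_sum, h, ZMod.card]
    split_ifs <;> simp [mul_comm, hN]
  | succ t ih =>
    rw [Function.iterate_succ_apply']
    fin_cases c
    · simp only [Fin.zero_eta, qwStep_coinC_zero, ih, modeAmp, Matrix.cons_val_zero,
        Finset.mul_sum, ← Finset.sum_add_distrib]
      refine Finset.sum_congr rfl fun k _ => ?_
      rw [mul_sub, mul_one, sub_eq_add_neg, AddChar.map_add_eq_mul, ← conj_stdAddChar]
      ring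
    · simp only [Fin.mk_one, qwStep_coinC_one, ih, modeAmp, Matrix.cons_val_one,
        Matrix.cons_val_zero, Finset.mul_sum, ← Finset.sum_add_distrib]
      refine Finset.sum_congr rfl fun k _ => ?_
      rw [mul_add k, mul_one, AddChar.map_add_eq_mul]
      ring

theorem ofReal_posDist_zero {N : ℕ} [NeZero N] (t : ℕ) :
    (posDist coinC (initState coin0 (0 : ZMod N)) t 0 : ℂ) =
      ((N : ℂ)⁻¹) ^ 2 * ∑ j : ZMod N, ∑ k : ZMod N,
        modeOverlap (ZMod.stdAddChar j) (ZMod.stdAddChar k) t := by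
  simp only [posDist, Complex.ofReal_sum, Complex.ofReal_pow, ← Complex.conj_mul',
    qwStep_iterate_initState, mul_zero, AddChar.map_zero_eq_one, mul_one, modeOverlap]
  simp only [Fin.sum_univ_two, Finset.sum_add_distrib, map_mul, map_sum, map_inv₀,
    Complex.conj_natCast, ← Finset.mul_sum, ← Finset.sum_mul]
  ring

/-- The Cesàro limit of the overlap of the momentum modes `j` and `k`. -/
noncomputable def overlapLimit {N : ℕ} [NeZero N] (j k : ZMod N) : ℝ :=
  if j = k then 1 else if j = -k then
    modeTrace (ZMod.stdAddChar k) ^ 2 / (4 - modeTrace (ZMod.stdAddChar k) ^ 2) else 0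

theorem tendsto_cesaro_modeOverlap {N : ℕ} [NeZero N] (j k : ZMod N) :
    Tendsto (fun T : ℕ => (T : ℂ)⁻¹ * ∑ t ∈ Finset.range T,
      modeOverlap (ZMod.stdAddChar j) (ZMod.stdAddChar k) t) atTop
      (nhds (overlapLimit j k : ℂ)) := by
  rw [overlapLimit]
  split_ifs with h1 h2
  · subst h1
    have := tendsto_cesaro_of_coboundary (s := fun _ => 1) (G := fun _ => 0) (a := 1) (q := 1)
      (B := 0) one_ne_zero (by simp) (by simp)
    simpa [modeOverlap_self] using this
  · subst h2
    rw [← conj_stdAddChar]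
    push_cast
    exact tendsto_cesaro_modeOverlap_conj (norm_stdAddChar k)
  · exact tendsto_cesaro_modeOverlap_zero (norm_stdAddChar j) (norm_stdAddChar k) fun h =>
      (eq_or_eq_neg_of_modeTrace_eq h).elim h1 h2

theorem tendsto_cesaroDist_zero {N : ℕ} [NeZero N] :
    Tendsto (fun T : ℕ => cesaroDist coinC (initState coin0 (0 : ZMod N)) T 0) atTop
      (nhds (((N : ℝ)⁻¹) ^ 2 * ∑ j : ZMod N, ∑ k : ZMod N, overlapLimit j k)) := by
  have h := (tendsto_finsetSum Finset.univ fun j _ => tendsto_finsetSum Finset.univ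
    fun k _ => tendsto_cesaro_modeOverlap (N := N) j k).const_mul (((N : ℂ)⁻¹) ^ 2)
  rw [← tendsto_ofReal_iff]
  push_cast
  refine h.congr fun T => ?_
  simp only [cesaroDist]
  push_cast
  simp only [ofReal_posDist_zero, ← Finset.mul_sum]
  rw [one_div, mul_left_comm, Finset.sum_comm (s := Finset.range T)]
  simp only [Finset.sum_comm (s := Finset.range T)]

theorem overlapLimit_nonneg {N : ℕ} [NeZero N] (j k : ZMod N) : 0 ≤ overlapLimit j k := by
  have := sub_pos.2 (modeTrace_sq_lt (norm_stdAddChar k))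
  rw [overlapLimit]
  split_ifs <;> positivity

theorem overlapLimit_neg_one_pos {N : ℕ} [NeZero N] (hN : 3 ≤ N) (hNodd : Odd N) :
    0 < overlapLimit (-1 : ZMod N) 1 := by
  have := sub_pos.2 (modeTrace_sq_lt (norm_stdAddChar (1 : ZMod N)))
  have h0 : modeTrace (ZMod.stdAddChar (1 : ZMod N)) ≠ 0 := by
    intro h
    have h' := ofReal_modeTrace (ZMod.stdAddChar (1 : ZMod N))
    have h2 : (Real.sqrt 2 : ℂ)⁻¹ ≠ 0 := by simp
    rw [h, Complex.ofReal_zero, eq_comm, mul_eq_zero, or_iff_right h2] at h'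
    have hk := mul_conj_of_norm_eq_one (norm_stdAddChar (1 : ZMod N))
    have h4 : ZMod.stdAddChar ((4 : ℕ) : ZMod N) = (1 : ℂ) := by
      rw [← nsmul_one, AddChar.map_nsmul_eq_pow]
      have : (ZMod.stdAddChar (1 : ZMod N) : ℂ) ^ 2 = -1 := by
        linear_combination ZMod.stdAddChar (1 : ZMod N) * h' - hk
      linear_combination ((ZMod.stdAddChar (1 : ZMod N) : ℂ) ^ 2 - 1) * this
    rw [← AddChar.map_zero_eq_one (ZMod.stdAddChar (N := N))] at h4
    have h5 := ZMod.injective_stdAddChar h4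
    rw [ZMod.natCast_eq_zero_iff] at h5
    have := Nat.le_of_dvd (by norm_num) h5
    obtain ⟨m, rfl⟩ := hNodd
    obtain rfl : m = 1 := by omega
    omega
  rw [overlapLimit]
  rw [if_pos rfl]
  split_ifs <;> positivity

/-- Non-uniformity of the Cesàro distribution for the coin `(I + iσ₁)/√2` on odd cycles:
for odd `N ≥ 3`, with initial coin state `c₀ = (|↑⟩+|↓⟩)/√2` and initial position `0`,
the time-averaged distribution does not converge to the uniform distribution. -/
theorem cesaro_not_uniform_unbiased_coin_odd_cycle
    (N : ℕ) [NeZero N] (hN : 3 ≤ N) (hNodd : Odd N) :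
    ∃ v : ZMod N, ¬ Tendsto (fun T : ℕ => cesaroDist coinC (initState coin0 (0 : ZMod N)) T v)
      atTop (nhds (1 / (N : ℝ))) := by
  refine ⟨0, fun h => ?_⟩
  have hlim := tendsto_nhds_unique h tendsto_cesaroDist_zero
  have hne : (1 : ZMod N) ≠ -1 := by
    intro h
    have h2 : ((2 : ℕ) : ZMod N) = 0 := by
      push_cast
      linear_combination h
    rw [ZMod.natCast_eq_zero_iff] at h2
    have := Nat.le_of_dvd (by norm_num) h2
    omega
  have hrow : ∀ j : ZMod N, 1 ≤ ∑ k, overlapLimit j k := fun j => by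
    have : overlapLimit j j = 1 := by simp [overlapLimit]
    rw [← this]
    exact Finset.single_le_sum (fun k _ => overlapLimit_nonneg j k) (Finset.mem_univ j)
  have hrow' : 1 < ∑ k, overlapLimit (-1 : ZMod N) k := by
    have h1 : overlapLimit (-1 : ZMod N) (-1) = 1 := by simp [overlapLimit]
    have := Finset.add_le_sum (fun k _ => overlapLimit_nonneg (-1 : ZMod N) k)
      (Finset.mem_univ 1) (Finset.mem_univ (-1)) hne
    have := overlapLimit_neg_one_pos hN hNodd
    linarith
  have hsum : (N : ℝ) < ∑ j : ZMod N, ∑ k, overlapLimit j k := by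
    calc (N : ℝ) = ∑ _j : ZMod N, (1 : ℝ) := by simp
      _ < _ := Finset.sum_lt_sum (fun j _ => hrow j) ⟨-1, Finset.mem_univ _, hrow'⟩
  have hN0 : (0 : ℝ) < N := by positivity
  field_simp at hlim
  linarith
end

section
/- Spectral structure of the reduced coin matrix: let N ≥ 1, k ∈ ℕ, and let H_k = Λ_k · C where Λ_k = diag(exp(2πik/N), exp(−2πik/N)) and C = (1/√2)·[[1, i],[i, 1]]. Then H_k has exactly two distinct eigenvalues, each eigenvalue λ has modulus |λ| = 1, and each eigenvalue satisfies Re(λ) = cos(2πk/N)/√2. -/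
open Filter

/-- The momentum matrix `Λ_k = diag(exp(2πik/N), exp(−2πik/N))`. -/
noncomputable def LambdaK (N k : ℕ) : Matrix (Fin 2) (Fin 2) ℂ :=
  !![Complex.exp (2 * (Real.pi : ℂ) * Complex.I * (k : ℂ) / (N : ℂ)), 0;
     0, Complex.exp (-(2 * (Real.pi : ℂ) * Complex.I * (k : ℂ)) / (N : ℂ))]

/-- The reduced coin matrix `H_k = Λ_k · C`. -/
noncomputable def Hk (N k : ℕ) : Matrix (Fin 2) (Fin 2) ℂ := LambdaK N k * coinC

/-- The eigenvalues of a `2 × 2` matrix are the roots of its characteristic polynomial. -/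
theorem Matrix.exists_mulVec_eq_smul_iff_fin_two {K : Type*} [Field K]
    (M : Matrix (Fin 2) (Fin 2) K) (l : K) :
    (∃ v : Fin 2 → K, v ≠ 0 ∧ M.mulVec v = l • v) ↔ l ^ 2 - M.trace * l + M.det = 0 := by
  have hdet : (M - l • (1 : Matrix (Fin 2) (Fin 2) K)).det =
      l ^ 2 - M.trace * l + M.det := by
    simp [Matrix.det_fin_two, Matrix.trace_fin_two]
    ring
  rw [← hdet, ← Matrix.exists_mulVec_eq_zero_iff]
  simp only [Matrix.sub_mulVec, Matrix.smul_mulVec, Matrix.one_mulVec, sub_eq_zero]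

theorem ofReal_sqrt_two_sq : (Real.sqrt 2 : ℂ) ^ 2 = 2 := by
  exact_mod_cast Real.sq_sqrt (by norm_num : (0 : ℝ) ≤ 2)

theorem Hk_det (N k : ℕ) : (Hk N k).det = 1 := by
  have h2 := ofReal_sqrt_two_sq
  have h0 : (Real.sqrt 2 : ℂ) ≠ 0 := by
    intro h
    simp [h] at h2
  rw [Hk, Matrix.det_mul, LambdaK, coinC, Matrix.det_smul, Matrix.det_fin_two_of,
    Matrix.det_fin_two_of, ← Complex.exp_add, neg_div, add_neg_cancel, Complex.exp_zero,
    Complex.I_mul_I, Fintype.card_fin, inv_pow, h2]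
  norm_num

theorem Hk_trace (N k : ℕ) :
    (Hk N k).trace = ((2 * (Real.cos (2 * Real.pi * k / N) / Real.sqrt 2) : ℝ) : ℂ) := by
  have harg : 2 * (Real.pi : ℂ) * Complex.I * k / N = (2 * Real.pi * k / N) * Complex.I := by
    ring
  have htrace : (Hk N k).trace = (Complex.exp ((2 * Real.pi * k / N) * Complex.I) +
      Complex.exp (-(2 * Real.pi * k / N) * Complex.I)) * (Real.sqrt 2 : ℂ)⁻¹ := by
    simp [Hk, LambdaK, coinC, Matrix.trace_fin_two,
      neg_div, harg]
    ring
  rw [htrace, ← Complex.two_cos]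
  push_cast
  ring

theorem sq_cos_div_sqrt_two_lt_one (x : ℝ) : (Real.cos x / Real.sqrt 2) ^ 2 < 1 := by
  rw [div_pow, Real.sq_sqrt (by norm_num)]
  linarith [Real.cos_sq_le_one x]

/-- For `c ^ 2 + s ^ 2 = 1`, the roots of `X ^ 2 - 2 * c * X + 1` are `c ± s * I`. -/
theorem sq_sub_two_mul_add_one_eq_zero_iff {c s : ℝ} (h : c ^ 2 + s ^ 2 = 1) (l : ℂ) :
    l ^ 2 - ((2 * c : ℝ) : ℂ) * l + 1 = 0 ↔ l = ⟨c, s⟩ ∨ l = ⟨c, -s⟩ := by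
  have hfactor : l ^ 2 - ((2 * c : ℝ) : ℂ) * l + 1 = (l - ⟨c, s⟩) * (l - ⟨c, -s⟩) := by
    apply Complex.ext <;> simp [pow_two] <;> linarith
  rw [hfactor, mul_eq_zero, sub_eq_zero, sub_eq_zero]

theorem norm_mk_eq_one {c s : ℝ} (h : c ^ 2 + s ^ 2 = 1) : ‖(⟨c, s⟩ : ℂ)‖ = 1 := by
  rw [Complex.norm_eq_sqrt_sq_add_sq, h, Real.sqrt_one]

/-- Spectral structure of the reduced coin matrix `H_k`: it has exactly two distinct
eigenvalues; every eigenvalue has modulus 1 and real part `cos(2πk/N)/√2`. -/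
theorem Hk_spectral_structure (N : ℕ) (hN : 1 ≤ N) (k : ℕ) :
    (∃ a b : ℂ, a ≠ b ∧
      {l : ℂ | ∃ v : Fin 2 → ℂ, v ≠ 0 ∧ (Hk N k).mulVec v = l • v} = {a, b}) ∧
    ∀ l : ℂ, (∃ v : Fin 2 → ℂ, v ≠ 0 ∧ (Hk N k).mulVec v = l • v) →
      ‖l‖ = 1 ∧ l.re = Real.cos (2 * Real.pi * k / N) / Real.sqrt 2 := by
  set c := Real.cos (2 * Real.pi * k / N) / Real.sqrt 2 with hc
  have hlt : c ^ 2 < 1 := sq_cos_div_sqrt_two_lt_one _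
  obtain ⟨s, hs, hcs⟩ : ∃ s : ℝ, 0 < s ∧ c ^ 2 + s ^ 2 = 1 :=
    ⟨Real.sqrt (1 - c ^ 2), Real.sqrt_pos.2 (by linarith), by
      rw [Real.sq_sqrt (by linarith)]
      ring⟩
  have heig (l : ℂ) : (∃ v : Fin 2 → ℂ, v ≠ 0 ∧ (Hk N k).mulVec v = l • v) ↔
      l = ⟨c, s⟩ ∨ l = ⟨c, -s⟩ := by
    rw [Matrix.exists_mulVec_eq_smul_iff_fin_two, Hk_trace, Hk_det, ← hc,
      sq_sub_two_mul_add_one_eq_zero_iff hcs]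
  refine ⟨⟨⟨c, s⟩, ⟨c, -s⟩, fun h => ?_, Set.ext heig⟩, fun l hl => ?_⟩
  · have him := congrArg Complex.im h
    dsimp only at him
    linarith
  · rcases (heig l).1 hl with rfl | rfl
    · exact ⟨norm_mk_eq_one hcs, rfl⟩
    · exact ⟨norm_mk_eq_one (by rwa [neg_sq]), rfl⟩
end

section
/- Reflection symmetry of the DTQW transition probability: let N ≥ 1 and m ∈ ℕ. For the DTQW on the N-cycle with coin C = (1/√2)·[[1, i],[i, 1]] and initial coin state c₀ = (|↑⟩ + |↓⟩)/√2, the m-step transition probability from the origin satisfies μ_m(x) = μ_m(−x) for all x ∈ ZMod N. -/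
open Filter

/-- Reflection of a walker state: swap the coin states and negate the position. -/
def reflectState {N : ℕ} (ψ : Fin 2 × ZMod N → ℂ) : Fin 2 × ZMod N → ℂ :=
  fun p => ψ (Equiv.swap 0 1 p.1, -p.2)

theorem qwStep_reflectState {N : ℕ} (ψ : Fin 2 × ZMod N → ℂ) :
    qwStep coinC (reflectState ψ) = reflectState (qwStep coinC ψ) := by
  funext ⟨c, x⟩
  have hsub : -(x - 1) = -x + 1 := by ring
  have hadd : -(x + 1) = -x - 1 := by ring
  fin_cases c <;>
    simp [qwStep, shiftOp, applyCoin, reflectState, coinC, hsub, hadd, Fin.sum_univ_two] <;>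
    ring_nf

theorem reflectState_initState {N : ℕ} :
    reflectState (initState coin0 (0 : ZMod N)) = initState coin0 0 := by
  funext p
  simp [reflectState, initState, coin0]

theorem reflectState_iterate_qwStep_initState {N : ℕ} (m : ℕ) :
    reflectState ((qwStep coinC)^[m] (initState coin0 (0 : ZMod N))) =
      (qwStep coinC)^[m] (initState coin0 0) := by
  have h : Function.Commute (reflectState (N := N)) (qwStep coinC) :=
    fun ψ => (qwStep_reflectState ψ).symm
  rw [(h.iterate_right m).eq, reflectState_initState]

/-- Reflection symmetry of the DTQW transition probability: with the coin
`C = (1/√2)·[[1, i],[i, 1]]` and initial coin state `c₀ = (|↑⟩ + |↓⟩)/√2`, the `m`-step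
transition probability from the origin satisfies `μ_m(x) = μ_m(−x)`. -/
theorem transProb_reflection_symmetric
    (N : ℕ) [NeZero N] (hN : 1 ≤ N) (m : ℕ) (x : ZMod N) :
    transProb N coinC m x 0 = transProb N coinC m (-x) 0 := by
  unfold transProb
  conv_lhs => rw [← reflectState_iterate_qwStep_initState m]
  simp [reflectState, Fin.sum_univ_two, add_comm]
end

section
/- Cesàro convergence for the Hadamard walk on odd cycles: let N ≥ 1 be odd and consider the DTQW on the N-cycle with the Hadamard coin C_H = (1/√2)·[[1, 1],[1, −1]] in place of C, with initial state Ψ₀ = γ ⊗ |0⟩ for an arbitrary unit coin state γ ∈ ℂ². Then the time-averaged distribution converges to the uniform distribution: for every v ∈ ZMod N, p̄_T(v) → 1/N as T → ∞. -/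
open Filter

/-- The Hadamard coin `C_H = (1/√2)·[[1, 1],[1, −1]]`. -/
noncomputable def coinH : Matrix (Fin 2) (Fin 2) ℂ :=
  ((Real.sqrt 2 : ℂ))⁻¹ • !![1, 1; 1, -1]

open Finset in
/-- The Cesàro means of the powers of a unimodular number `μ ≠ 1` tend to zero. -/
lemma tendsto_cesaro_pow_zero {μ : ℂ} (hμ : ‖μ‖ = 1) (h1 : μ ≠ 1) :
    Tendsto (fun T : ℕ => (1 / (T : ℂ)) * ∑ t ∈ range T, μ ^ t) atTop (nhds 0) := by
  have hb : ∀ T : ℕ, ‖(1 / (T : ℂ)) * ∑ t ∈ range T, μ ^ t‖ ≤ (2 / ‖μ - 1‖) * (1 / (T : ℝ)) := by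
    intro T
    rw [geom_sum_eq h1, norm_mul, norm_div, norm_div, norm_one, Complex.norm_natCast, mul_comm]
    gcongr
    calc ‖μ ^ T - 1‖ ≤ ‖μ ^ T‖ + ‖(1 : ℂ)‖ := norm_sub_le _ _
      _ = 2 := by rw [norm_pow, hμ, one_pow, norm_one]; norm_num
  refine squeeze_zero_norm hb ?_
  simpa using (tendsto_one_div_atTop_nhds_zero_nat (𝕜 := ℝ)).const_mul (2 / ‖μ - 1‖)

/-- The Cesàro means of a constant sequence. -/
lemma tendsto_cesaro_one :
    Tendsto (fun T : ℕ => (1 / (T : ℂ)) * ∑ _t ∈ Finset.range T, (1 : ℂ)) atTop (nhds 1) := by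
  refine tendsto_const_nhds.congr' ?_
  filter_upwards [eventually_gt_atTop 0] with T hT
  have : (T : ℂ) ≠ 0 := by exact_mod_cast hT.ne'
  simp [this]

/-- Parseval's identity for the Cesàro mean of the squared modulus of a trigonometric polynomial
with distinct unimodular frequencies. -/
lemma tendsto_cesaro_norm_sq {J : Type*} [Fintype J] {μ : J → ℂ} (hinj : Function.Injective μ)
    (hμ : ∀ j, ‖μ j‖ = 1) (b : J → ℂ) :
    Tendsto (fun T : ℕ => (1 / (T : ℝ)) * ∑ t ∈ Finset.range T, ‖∑ j, μ j ^ t * b j‖ ^ 2)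
      atTop (nhds (∑ j, ‖b j‖ ^ 2)) := by
  classical
  have key : Tendsto (fun T : ℕ => ∑ i, ∑ j, (b i * star (b j)) *
      ((1 / (T : ℂ)) * ∑ t ∈ Finset.range T, (μ i * star (μ j)) ^ t)) atTop
      (nhds (∑ i, ∑ j, (b i * star (b j)) * if i = j then 1 else 0)) := by
    refine tendsto_finsetSum _ fun i _ => tendsto_finsetSum _ fun j _ => Tendsto.const_mul _ ?_
    have hself : ∀ j, μ j * star (μ j) = 1 := fun j => by
      rw [Complex.star_def, Complex.mul_conj']; simp [hμ]
    split_ifs with h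
    · subst h
      simpa only [hself, one_pow, if_true] using tendsto_cesaro_one
    · refine tendsto_cesaro_pow_zero (by simp [hμ]) fun h1 => h (hinj ?_)
      have hs : star (μ j) * μ j = 1 := by rw [mul_comm, hself]
      calc μ i = μ i * (star (μ j) * μ j) := by rw [hs, mul_one]
        _ = μ j := by rw [← mul_assoc, h1, one_mul]
  rw [← Filter.tendsto_ofReal_iff]
  convert key using 2
  · rename_i T
    push_cast
    simp_rw [← Complex.mul_conj', map_sum, Finset.sum_mul_sum, Finset.mul_sum]
    rw [Finset.sum_comm]
    refine Finset.sum_congr rfl fun i _ => ?_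
    rw [Finset.sum_comm]
    refine Finset.sum_congr rfl fun j _ => Finset.sum_congr rfl fun t _ => ?_
    simp only [map_mul, map_pow, Complex.star_def, mul_pow]
    ring
  · push_cast
    simp [← Complex.mul_conj']

lemma inv_sqrt_two_mul_self : ((Real.sqrt 2 : ℂ))⁻¹ * ((Real.sqrt 2 : ℂ))⁻¹ = 1 / 2 := by
  rw [← mul_inv, ← Complex.ofReal_mul, Real.mul_self_sqrt (by norm_num)]
  norm_num

lemma qwStep_coinH_apply_zero {N : ℕ} (ψ : Fin 2 × ZMod N → ℂ) (x : ZMod N) :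
    qwStep coinH ψ (0, x) = ((Real.sqrt 2 : ℂ))⁻¹ * (ψ (0, x - 1) + ψ (1, x - 1)) := by
  simp [qwStep, shiftOp, applyCoin, coinH, mul_add]

lemma qwStep_coinH_apply_one {N : ℕ} (ψ : Fin 2 × ZMod N → ℂ) (x : ZMod N) :
    qwStep coinH ψ (1, x) = ((Real.sqrt 2 : ℂ))⁻¹ * (ψ (0, x + 1) - ψ (1, x + 1)) := by
  simp [qwStep, shiftOp, applyCoin, coinH, sub_eq_add_neg, mul_add]

/-- The Hadamard walk is linear. -/
noncomputable def hadamardStep (N : ℕ) :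
    (Fin 2 × ZMod N → ℂ) →ₗ[ℂ] (Fin 2 × ZMod N → ℂ) where
  toFun := qwStep coinH
  map_add' ψ φ := by
    ext ⟨c, x⟩
    fin_cases c
    · simp [qwStep_coinH_apply_zero]; ring
    · simp [qwStep_coinH_apply_one]; ring
  map_smul' a ψ := by
    ext ⟨c, x⟩
    fin_cases c
    · simp [qwStep_coinH_apply_zero]; ring
    · simp [qwStep_coinH_apply_one]; ring

/-- The total probability is preserved by the Hadamard walk. -/
lemma sum_norm_sq_qwStep_coinH {N : ℕ} [NeZero N] (ψ : Fin 2 × ZMod N → ℂ) :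
    ∑ v, ∑ c, ‖qwStep coinH ψ (c, v)‖ ^ 2 = ∑ v, ∑ c, ‖ψ (c, v)‖ ^ 2 := by
  have hs : ‖((Real.sqrt 2 : ℂ))⁻¹‖ ^ 2 = 1 / 2 := by
    rw [← norm_pow, pow_two, inv_sqrt_two_mul_self]; norm_num
  simp only [Fin.sum_univ_two, qwStep_coinH_apply_zero, qwStep_coinH_apply_one, norm_mul, mul_pow,
    hs, Finset.sum_add_distrib]
  have e1 := (Equiv.subRight (1 : ZMod N)).sum_comp
    fun x => 1 / 2 * ‖ψ (0, x) + ψ (1, x)‖ ^ 2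
  have e2 := Equiv.sum_comp (Equiv.addRight (1 : ZMod N))
    fun x => 1 / 2 * ‖ψ (0, x) - ψ (1, x)‖ ^ 2
  simp only [Equiv.subRight_apply, Equiv.coe_addRight] at e1 e2
  rw [e1, e2, ← Finset.sum_add_distrib, ← Finset.sum_add_distrib]
  refine Finset.sum_congr rfl fun x _ => ?_
  have := parallelogram_law_with_norm ℂ (ψ (0, x)) (ψ (1, x))
  linarith

lemma sum_posDist_coinH {N : ℕ} [NeZero N] (ψ : Fin 2 × ZMod N → ℂ) (t : ℕ) :
    ∑ v, posDist coinH ψ t v = ∑ v, ∑ c, ‖ψ (c, v)‖ ^ 2 := by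
  induction t with
  | zero => rfl
  | succ t ih =>
    rw [← ih]
    simp only [posDist, Function.iterate_succ_apply']
    exact sum_norm_sq_qwStep_coinH _

/-- The Fourier phase `exp (2πik/N)`. -/
noncomputable def fourierPhase {N : ℕ} [NeZero N] (k : ZMod N) : ℂ := ZMod.stdAddChar k

lemma norm_fourierPhase {N : ℕ} [NeZero N] (k : ZMod N) : ‖fourierPhase k‖ = 1 :=
  AddChar.norm_apply _ _

/-- The eigenvalues of the Hadamard walk: the two roots of `μ ^ 2 + √2 i (sin θ) μ - 1`, where
`θ` is the argument of the Fourier phase. -/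
noncomputable def hadamardEigenvalue {N : ℕ} [NeZero N] (j : ZMod N × Bool) : ℂ :=
  ⟨(if j.2 then 1 else -1) * Real.sqrt (1 - (fourierPhase j.1).im ^ 2 / 2),
    -((fourierPhase j.1).im / Real.sqrt 2)⟩

lemma fourierPhase_sq_add_sq {N : ℕ} [NeZero N] (k : ZMod N) :
    (fourierPhase k).re ^ 2 + (fourierPhase k).im ^ 2 = 1 := by
  have := Complex.sq_norm (fourierPhase k)
  rw [norm_fourierPhase, Complex.normSq_apply] at this
  linarith

lemma hadamardEigenvalue_radicand_pos {N : ℕ} [NeZero N] (k : ZMod N) :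
    0 < 1 - (fourierPhase k).im ^ 2 / 2 := by
  nlinarith [fourierPhase_sq_add_sq k, sq_nonneg (fourierPhase k).re]

lemma norm_hadamardEigenvalue {N : ℕ} [NeZero N] (j : ZMod N × Bool) :
    ‖hadamardEigenvalue j‖ = 1 := by
  have hr := Real.mul_self_sqrt (hadamardEigenvalue_radicand_pos j.1).le
  have h2 : (Real.sqrt 2) ^ 2 = 2 := Real.sq_sqrt (by norm_num)
  rw [← sq_eq_sq₀ (norm_nonneg _) zero_le_one, Complex.sq_norm, Complex.normSq_apply]
  have hi : (fourierPhase j.1).im / Real.sqrt 2 * ((fourierPhase j.1).im / Real.sqrt 2) =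
      (fourierPhase j.1).im ^ 2 / 2 := by
    rw [div_mul_div_comm, ← pow_two, ← pow_two, h2]
  simp only [hadamardEigenvalue]
  split_ifs <;> nlinarith

/-- On an odd cycle the imaginary part of the Fourier phase determines the frequency. -/
lemma fourierPhase_im_injective {N : ℕ} [NeZero N] (hN : Odd N) :
    Function.Injective fun k : ZMod N => (fourierPhase k).im := by
  intro k l h
  have h : (fourierPhase k).im = (fourierPhase l).im := h
  have hk := fourierPhase_sq_add_sq k
  have hl := fourierPhase_sq_add_sq l
  have hre : (fourierPhase k).re ^ 2 = (fourierPhase l).re ^ 2 := by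
    rw [h] at hk; linarith
  rcases sq_eq_sq_iff_eq_or_eq_neg.1 hre with hr | hr
  · exact ZMod.injective_stdAddChar (Complex.ext hr h)
  · exfalso
    have hmul : fourierPhase (k + l) = -1 := by
      have : fourierPhase (k + l) = fourierPhase k * fourierPhase l :=
        AddChar.map_add_eq_mul _ _ _
      rw [this]
      apply Complex.ext
      · simp [hr, h]; linarith
      · simp [hr, h]; ring
    have hpow : fourierPhase (k + l) ^ N = 1 := by
      rw [fourierPhase, ← AddChar.map_nsmul_eq_pow]
      simp
    rw [hmul, hN.neg_one_pow] at hpow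
    norm_num at hpow

lemma hadamardEigenvalue_injective {N : ℕ} [NeZero N] (hN : Odd N) :
    Function.Injective (hadamardEigenvalue (N := N)) := by
  rintro ⟨k, s⟩ ⟨l, s'⟩ h
  have him := congrArg Complex.im h
  have hre := congrArg Complex.re h
  simp only [hadamardEigenvalue, neg_inj] at him hre
  have hkl : k = l := fourierPhase_im_injective hN ((div_left_inj' (by positivity)).1 him)
  subst hkl
  have hpos := Real.sqrt_pos.2 (hadamardEigenvalue_radicand_pos k)
  have hs : s = s' := by
    cases s <;> cases s' <;> simp at hre ⊢ <;> linarith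
  rw [hs]

/-- The plane wave with coin state `a` and frequency `k`. -/
noncomputable def planeWave {N : ℕ} [NeZero N] (k : ZMod N) (a : Fin 2 → ℂ) :
    Fin 2 × ZMod N → ℂ :=
  fun p => a p.1 * fourierPhase (k * p.2)

/-- The action of the Hadamard walk on the coin state of a plane wave. -/
noncomputable def hadamardSymbol {N : ℕ} [NeZero N] (k : ZMod N) (a : Fin 2 → ℂ) : Fin 2 → ℂ :=
  ![((Real.sqrt 2 : ℂ))⁻¹ * star (fourierPhase k) * (a 0 + a 1),
    ((Real.sqrt 2 : ℂ))⁻¹ * fourierPhase k * (a 0 - a 1)]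

lemma qwStep_planeWave {N : ℕ} [NeZero N] (k : ZMod N) (a : Fin 2 → ℂ) :
    qwStep coinH (planeWave k a) = planeWave k (hadamardSymbol k a) := by
  ext ⟨c, x⟩
  have hadd : fourierPhase (k * (x + 1)) = fourierPhase k * fourierPhase (k * x) := by
    rw [mul_add, mul_one, add_comm]; exact AddChar.map_add_eq_mul _ _ _
  have hsub : fourierPhase (k * (x - 1)) = star (fourierPhase k) * fourierPhase (k * x) := by
    rw [mul_sub, mul_one, sub_eq_neg_add]
    refine (AddChar.map_add_eq_mul _ _ _).trans ?_
    rw [AddChar.map_neg_eq_conj]; rfl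
  fin_cases c
  · simp [qwStep_coinH_apply_zero, planeWave, hadamardSymbol, hsub]; ring
  · simp [qwStep_coinH_apply_one, planeWave, hadamardSymbol, hadd]; ring

/-- The component of the coin state `γ` in the eigenspace of the symbol at `j.1` for the
eigenvalue `hadamardEigenvalue j`. -/
noncomputable def eigenComponent {N : ℕ} [NeZero N] (γ : Fin 2 → ℂ) (j : ZMod N × Bool) :
    Fin 2 → ℂ :=
  fun c => (hadamardSymbol j.1 γ c - hadamardEigenvalue (j.1, !j.2) * γ c) /
    (hadamardEigenvalue j - hadamardEigenvalue (j.1, !j.2))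

lemma hadamardEigenvalue_sub_ne_zero {N : ℕ} [NeZero N] (k : ZMod N) :
    hadamardEigenvalue (k, true) - hadamardEigenvalue (k, false) ≠ 0 := by
  intro h
  have hre := congrArg Complex.re h
  have hpos := Real.sqrt_pos.2 (hadamardEigenvalue_radicand_pos k)
  simp [hadamardEigenvalue] at hre
  linarith

lemma eigenComponent_add {N : ℕ} [NeZero N] (γ : Fin 2 → ℂ) (k : ZMod N) (c : Fin 2) :
    eigenComponent γ (k, true) c + eigenComponent γ (k, false) c = γ c := by
  have h := hadamardEigenvalue_sub_ne_zero k
  have h' : hadamardEigenvalue (k, false) - hadamardEigenvalue (k, true) ≠ 0 := by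
    rwa [← neg_sub, neg_ne_zero]
  simp only [eigenComponent, Bool.not_true, Bool.not_false]
  field_simp
  ring

lemma hadamardEigenvalue_add {N : ℕ} [NeZero N] (j : ZMod N × Bool) :
    hadamardEigenvalue j + hadamardEigenvalue (j.1, !j.2) =
      ((Real.sqrt 2 : ℂ))⁻¹ * (star (fourierPhase j.1) - fourierPhase j.1) := by
  obtain ⟨k, s⟩ := j
  have h2 : ((Real.sqrt 2 : ℂ))⁻¹ = (((Real.sqrt 2)⁻¹ : ℝ) : ℂ) := by push_cast; rfl
  rw [h2]
  apply Complex.ext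
  · cases s <;> simp [hadamardEigenvalue]
  · have h3 : Real.sqrt 2 * Real.sqrt 2 = 2 := Real.mul_self_sqrt (by norm_num)
    cases s <;> simp [hadamardEigenvalue] <;> field_simp <;> linear_combination 2 * (fourierPhase k).im * h3

lemma hadamardEigenvalue_mul {N : ℕ} [NeZero N] (j : ZMod N × Bool) :
    hadamardEigenvalue j * hadamardEigenvalue (j.1, !j.2) = -1 := by
  have hstar : hadamardEigenvalue (j.1, !j.2) = -star (hadamardEigenvalue j) := by
    obtain ⟨k, s⟩ := j
    apply Complex.ext <;> cases s <;> simp [hadamardEigenvalue]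
  rw [hstar, mul_neg, Complex.star_def, Complex.mul_conj', norm_hadamardEigenvalue]
  norm_num

lemma hadamardSymbol_eigenComponent {N : ℕ} [NeZero N] (γ : Fin 2 → ℂ) (j : ZMod N × Bool) :
    hadamardSymbol j.1 (eigenComponent γ j) = hadamardEigenvalue j • eigenComponent γ j := by
  have hadd := hadamardEigenvalue_add j
  have hmul := hadamardEigenvalue_mul j
  have hz : fourierPhase j.1 * star (fourierPhase j.1) = 1 := by
    rw [Complex.star_def, Complex.mul_conj', norm_fourierPhase]; norm_num
  have hs := inv_sqrt_two_mul_self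
  ext c
  simp only [Pi.smul_apply, smul_eq_mul]
  fin_cases c
  all_goals
    simp only [hadamardSymbol, eigenComponent, Fin.zero_eta, Fin.mk_one, Matrix.cons_val_zero,
      Matrix.cons_val_one]
    generalize ((Real.sqrt 2 : ℂ))⁻¹ = q at *
    generalize star (fourierPhase j.1) = w at *
    generalize fourierPhase j.1 = z at *
    generalize hadamardEigenvalue (j.1, !j.2) = m at *
    generalize hadamardEigenvalue j = l at *
    simp only [← add_div, ← sub_div, ← mul_div_assoc]
    congr 1
  · linear_combination -(q * w * (γ 0 + γ 1)) * hadd + γ 0 * hmul + 2 * γ 0 * (z * w) * hs +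
      γ 0 * hz
  · linear_combination -(q * z * (γ 0 - γ 1)) * hadd + γ 1 * hmul + 2 * γ 1 * (z * w) * hs +
      γ 1 * hz

lemma initState_eq_sum {N : ℕ} [NeZero N] (γ : Fin 2 → ℂ) :
    initState γ (0 : ZMod N) =
      ∑ j : ZMod N × Bool, planeWave j.1 ((N : ℂ)⁻¹ • eigenComponent γ j) := by
  have hN : (N : ℂ) ≠ 0 := NeZero.ne _
  ext ⟨c, x⟩
  have hsum : ∑ k : ZMod N, fourierPhase (k * x) = if x = 0 then (N : ℂ) else 0 := by
    have := AddChar.sum_mulShift x (ZMod.isPrimitive_stdAddChar N)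
    simpa [ZMod.card, fourierPhase] using this
  rw [Finset.sum_apply, Fintype.sum_prod_type]
  simp only [Fintype.sum_bool, planeWave, Pi.smul_apply, smul_eq_mul, ← add_mul, ← mul_add,
    eigenComponent_add]
  rw [← Finset.mul_sum, hsum, initState]
  split_ifs
  · field_simp
  · simp

lemma iterate_qwStep_coinH_initState {N : ℕ} [NeZero N] (γ : Fin 2 → ℂ) (t : ℕ) :
    (qwStep coinH)^[t] (initState γ (0 : ZMod N)) = ∑ j : ZMod N × Bool,
      hadamardEigenvalue j ^ t • planeWave j.1 ((N : ℂ)⁻¹ • eigenComponent γ j) := by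
  induction t with
  | zero => simpa using initState_eq_sum γ
  | succ t ih =>
    rw [Function.iterate_succ_apply', ih]
    change hadamardStep N _ = _
    rw [map_sum]
    refine Finset.sum_congr rfl fun j _ => ?_
    rw [map_smul, pow_succ, mul_smul]
    congr 1
    have hsmul : ∀ (s : ℂ) (a : Fin 2 → ℂ), planeWave j.1 (s • a) = s • planeWave j.1 a :=
      fun s a => by ext p; simp [planeWave, mul_assoc]
    rw [hsmul, map_smul, smul_comm]
    congr 1
    refine (qwStep_planeWave _ _).trans ?_
    rw [hadamardSymbol_eigenComponent, hsmul]

/-- The time-averaged distribution converges to a limit that does not depend on the vertex. -/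
lemma tendsto_cesaroDist_coinH {N : ℕ} [NeZero N] (hN : Odd N) (γ : Fin 2 → ℂ) (v : ZMod N) :
    Tendsto (fun T : ℕ => cesaroDist coinH (initState γ (0 : ZMod N)) T v) atTop
      (nhds (∑ c, ∑ j : ZMod N × Bool, ‖(N : ℂ)⁻¹ * eigenComponent γ j c‖ ^ 2)) := by
  have h := tendsto_finsetSum Finset.univ fun (c : Fin 2) _ =>
    tendsto_cesaro_norm_sq (hadamardEigenvalue_injective hN) norm_hadamardEigenvalue
      fun j => planeWave j.1 ((N : ℂ)⁻¹ • eigenComponent γ j) (c, v)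
  convert h using 2
  · rename_i T
    simp only [cesaroDist, posDist, iterate_qwStep_coinH_initState, Finset.sum_apply,
      Pi.smul_apply, smul_eq_mul]
    rw [Finset.sum_comm, Finset.mul_sum]
  · simp [planeWave, norm_fourierPhase]

/-- Cesàro convergence for the Hadamard walk on odd cycles: for odd `N`, with initial state
`γ ⊗ |0⟩` for an arbitrary unit coin state `γ`, the time-averaged distribution converges
to the uniform distribution `1/N` at every vertex. -/
theorem cesaro_uniform_hadamard_odd_cycle
    (N : ℕ) [NeZero N] (hN : 1 ≤ N) (hNodd : Odd N)
    (γ : Fin 2 → ℂ) (hγ : ‖γ 0‖ ^ 2 + ‖γ 1‖ ^ 2 = 1) :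
    ∀ v : ZMod N,
      Tendsto (fun T : ℕ => cesaroDist coinH (initState γ (0 : ZMod N)) T v)
        atTop (nhds (1 / (N : ℝ))) := by
  intro v
  set L : ℝ := ∑ c, ∑ j : ZMod N × Bool, ‖(N : ℂ)⁻¹ * eigenComponent γ j c‖ ^ 2 with hL
  have hlim : ∀ v : ZMod N, Tendsto
      (fun T : ℕ => cesaroDist coinH (initState γ (0 : ZMod N)) T v) atTop (nhds L) :=
    tendsto_cesaroDist_coinH hNodd γ
  have hsum := tendsto_finsetSum Finset.univ fun v _ => hlim v
  have hone : Tendsto (fun T : ℕ => ∑ v, cesaroDist coinH (initState γ (0 : ZMod N)) T v)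
      atTop (nhds 1) := by
    refine tendsto_const_nhds.congr' ?_
    filter_upwards [eventually_gt_atTop 0] with T hT
    have hT' : (T : ℝ) ≠ 0 := by exact_mod_cast hT.ne'
    have hinit : ∑ v : ZMod N, ∑ c, ‖initState γ (0 : ZMod N) (c, v)‖ ^ 2 = 1 := by
      rw [Finset.sum_eq_single 0 (fun v _ hv => by simp [initState, hv]) (by simp)]
      simpa [initState] using hγ
    simp only [cesaroDist]
    rw [← Finset.mul_sum, Finset.sum_comm]
    simp only [sum_posDist_coinH, hinit]
    simp [hT']
  have hNL := tendsto_nhds_unique hsum hone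
  have hN0 : (N : ℝ) ≠ 0 := NeZero.ne _
  have : L = 1 / (N : ℝ) := by
    rw [eq_div_iff hN0, mul_comm]
    simpa [ZMod.card] using hNL
  rw [← this]
  exact hlim v
end
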